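/- Every minor of the infinite lower triangular matrix L^B is a polynomial in q with nonnegative coefficients. Precisely: for every k ≥ 1 and all strictly increasing sequences 0 ≤ i_1 < ... < i_k and 0 ≤ j_1 < ... < j_k, the determinant of the k × k matrix whose (s,t) entry is l_{i_s, j_t} has all coefficients nonnegative. -/

import Mathlib

open Polynomial

/-- The entries of the coefficient matrix `L^B`:
`l_{i,i} = 1`, `l_{i,i-1} = 1+q` (for `i ≥ 1`), `l_{2,0} = 2q`,
`l_{i,i-2} = q` (for `i ≥ 3`), and `l_{i,j} = 0` otherwise. -/
noncomputable def LB (i j : ℕ) : Polynomial ℝ :=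
  if i = j then 1
  else if i = j + 1 then 1 + Polynomial.X
  else if i = 2 ∧ j = 0 then 2 * Polynomial.X
  else if i = j + 2 ∧ 3 ≤ i then Polynomial.X
  else 0

/-- All coefficients nonnegative. -/
def QNN (p : Polynomial ℝ) : Prop := ∀ m, 0 ≤ p.coeff m

lemma QNN.add {p r : Polynomial ℝ} (hp : QNN p) (hr : QNN r) : QNN (p + r) := by
  intro m
  rw [coeff_add]
  exact add_nonneg (hp m) (hr m)

lemma QNN.mul {p r : Polynomial ℝ} (hp : QNN p) (hr : QNN r) : QNN (p * r) := by
  intro m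
  rw [coeff_mul]
  exact Finset.sum_nonneg fun x _ => mul_nonneg (hp _) (hr _)

lemma QNN.zero : QNN 0 := by intro m; simp

lemma QNN.one : QNN 1 := by
  intro m
  rw [coeff_one]
  split_ifs <;> norm_num

lemma QNN.X : QNN (X : Polynomial ℝ) := by
  intro m
  rw [coeff_X]
  split_ifs <;> norm_num

lemma QNN.sum {ι : Type*} (s : Finset ι) (f : ι → Polynomial ℝ) (h : ∀ x ∈ s, QNN (f x)) :
    QNN (∑ x ∈ s, f x) := by
  intro m
  rw [finsetSum_coeff]
  exact Finset.sum_nonneg fun x hx => h x hx m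

lemma QNN.prod {ι : Type*} (s : Finset ι) (f : ι → Polynomial ℝ) (h : ∀ x ∈ s, QNN (f x)) :
    QNN (∏ x ∈ s, f x) :=
  Finset.prod_induction f QNN (fun _ _ => QNN.mul) QNN.one h

/-- Total positivity of an infinite matrix. -/
def QTP (M : ℕ → ℕ → Polynomial ℝ) : Prop :=
  ∀ (k : ℕ) (i j : Fin k → ℕ), StrictMono i → StrictMono j →
    QNN (Matrix.det (Matrix.of fun s t : Fin k => M (i s) (j t)))

/-- The infinite identity matrix. -/
noncomputable def idM (i j : ℕ) : Polynomial ℝ := if i = j then 1 else 0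

lemma QTP_idM : QTP idM := by
  intro k i j hi hj
  by_cases h : ∀ s, i s ∈ Set.range j
  · have hr : Set.range i = Set.range j := by
      apply Set.eq_of_subset_of_ncard_le
      · rintro _ ⟨s, rfl⟩
        exact h s
      · rw [← Set.image_univ, ← Set.image_univ, Set.ncard_image_of_injective _ hi.injective,
          Set.ncard_image_of_injective _ hj.injective]
      · exact Set.finite_range j
    have hij : i = j := (StrictMono.range_inj hi hj).1 hr
    subst hij
    have : (Matrix.of fun s t : Fin k => idM (i s) (i t)) = 1 := by
      ext1 s t
      simp [idM, Matrix.one_apply, hi.injective.eq_iff]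
    rw [this, Matrix.det_one]
    exact QNN.one
  · push Not at h
    obtain ⟨s, hs⟩ := h
    rw [Matrix.det_eq_zero_of_row_eq_zero s]
    · exact QNN.zero
    · intro t
      have : i s ≠ j t := fun e => hs ⟨t, e.symm⟩
      simp [idM, this]

/-- Left multiplication by a lower bidiagonal matrix. -/
noncomputable def bid (d c : ℕ → Polynomial ℝ) (M : ℕ → ℕ → Polynomial ℝ) (i j : ℕ) :
    Polynomial ℝ := d i * M i j + c i * M (i - 1) j

lemma QTP.bid {M : ℕ → ℕ → Polynomial ℝ} (hM : QTP M) (d c : ℕ → Polynomial ℝ)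
    (hd : ∀ n, QNN (d n)) (hc : ∀ n, QNN (c n)) : QTP (bid d c M) := by
  classical
  intro k i j hi hj
  have e : Matrix.det (Matrix.of fun s t : Fin k => _root_.bid d c M (i s) (j t)) =
      (Matrix.detRowAlternating (R := Polynomial ℝ) (n := Fin k)).toMultilinearMap
        ((fun s => d (i s) • fun t => M (i s) (j t)) +
          (fun s => c (i s) • fun t => M (i s - 1) (j t))) := rfl
  rw [e, MultilinearMap.map_add_univ]
  apply QNN.sum
  intro S _
  have e2 : S.piecewise (fun s => d (i s) • fun t => M (i s) (j t))
      (fun s => c (i s) • fun t => M (i s - 1) (j t)) =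
      fun s => (if s ∈ S then d (i s) else c (i s)) •
        fun t => M (if s ∈ S then i s else i s - 1) (j t) := by
    funext s
    by_cases hs : s ∈ S <;> simp [hs]
  rw [e2, MultilinearMap.map_smul_univ, smul_eq_mul]
  apply QNN.mul
  · apply QNN.prod
    intro s _
    split_ifs
    · exact hd _
    · exact hc _
  · set i' : Fin k → ℕ := fun s => if s ∈ S then i s else i s - 1 with hi'
    have hmono : Monotone i' := by
      intro a b hab
      rcases hab.eq_or_lt with rfl | hab
      · exact le_rfl
      · have := hi hab
        simp only [hi']
        split_ifs <;> omega
    change QNN (Matrix.det (Matrix.of fun s t : Fin k => M (i' s) (j t)))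
    by_cases hinj : Function.Injective i'
    · exact hM k i' j (hmono.strictMono_of_injective hinj) hj
    · simp only [Function.Injective] at hinj
      push Not at hinj
      obtain ⟨a, b, hab, hne⟩ := hinj
      rw [Matrix.det_zero_of_row_eq hne]
      · exact QNN.zero
      · funext t
        simp [hab]

noncomputable def P0 : ℕ → ℕ → Polynomial ℝ :=
  bid (fun _ => 1) (fun n => if n ≤ 1 then 0 else 1)
    (bid (fun _ => 1) (fun n => if n ≤ 1 then 0 else X) idM)

noncomputable def P1 : ℕ → ℕ → Polynomial ℝ :=
  bid (fun _ => 1) (fun n => if n = 0 then 0 else X)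
    (bid (fun n => if n = 0 then 0 else 1) (fun n => if n = 0 then 0 else 1) idM)

noncomputable def P2 : ℕ → ℕ → Polynomial ℝ :=
  bid (fun _ => 1) (fun n => if n = 0 then 0 else 1)
    (bid (fun n => if n = 0 then 0 else 1)
      (fun n => if n = 0 then 0 else if n = 1 then 1 else X) idM)

lemma QTP_P0 : QTP P0 := by
  refine QTP.bid (QTP.bid QTP_idM _ _ ?_ ?_) _ _ ?_ ?_ <;> intro n <;>
    (try split_ifs) <;> first | exact QNN.zero | exact QNN.one | exact QNN.X

lemma QTP_P1 : QTP P1 := by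
  refine QTP.bid (QTP.bid QTP_idM _ _ ?_ ?_) _ _ ?_ ?_ <;> intro n <;>
    (try split_ifs) <;> first | exact QNN.zero | exact QNN.one | exact QNN.X

lemma QTP_P2 : QTP P2 := by
  refine QTP.bid (QTP.bid QTP_idM _ _ ?_ ?_) _ _ ?_ ?_ <;> intro n <;>
    (try split_ifs) <;> first | exact QNN.zero | exact QNN.one | exact QNN.X

lemma P0_eq (i j : ℕ) (hj : j ≠ 0) : P0 i j = LB i j := by
  simp only [P0, bid, idM, LB]
  split_ifs <;> first | omega | ring

lemma P1_eq (i j : ℕ) (hj : j ≠ 0) : P1 i j = LB i j := by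
  simp only [P1, bid, idM, LB]
  split_ifs <;> first | omega | ring

lemma P2_eq (i j : ℕ) (hj : j ≠ 0) : P2 i j = LB i j := by
  simp only [P2, bid, idM, LB]
  split_ifs <;> first | omega | ring

lemma LB_zero (i : ℕ) : LB i 0 = P0 i 0 + P1 i 0 + X * P2 i 0 := by
  simp only [P0, P1, P2, bid, idM, LB]
  rcases i with _ | _ | _ | i
  · simp
  · simp
  · simp; ring
  · simp

/-- Every minor of the matrix `L^B` has nonnegative coefficients. -/
theorem LB_q_totally_positive
    (k : ℕ) (hk : 1 ≤ k)
    (i j : Fin k → ℕ) (hi : StrictMono i) (hj : StrictMono j) (m : ℕ) :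
    0 ≤ (Matrix.det (Matrix.of fun s t : Fin k => LB (i s) (j t))).coeff m := by
  revert m
  change QNN _
  obtain ⟨n, rfl⟩ : ∃ n, k = n + 1 := ⟨k - 1, by omega⟩
  have hpos : ∀ t, t ≠ 0 → j t ≠ 0 := by
    intro t ht
    have := hj (Fin.pos_of_ne_zero ht)
    omega
  by_cases h0 : j 0 = 0
  · set A : Matrix (Fin (n + 1)) (Fin (n + 1)) (Polynomial ℝ) :=
      Matrix.of fun s t => LB (i s) (j t) with hA
    have key : ∀ P : ℕ → ℕ → Polynomial ℝ, (∀ a b, b ≠ 0 → P a b = LB a b) →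
        A.updateCol 0 (fun s => P (i s) 0) = Matrix.of fun s t => P (i s) (j t) := by
      intro P hP
      ext1 s t
      by_cases ht : t = 0
      · subst ht
        simp [h0]
      · simp [Matrix.updateCol_ne ht, hA, hP _ _ (hpos t ht)]
    have hAe : A = A.updateCol 0 ((fun s => P0 (i s) 0) + (fun s => P1 (i s) 0) +
        (X : Polynomial ℝ) • (fun s => P2 (i s) 0)) := by
      refine (key LB (fun _ _ _ => rfl)).symm.trans ?_
      congr 1
      funext s
      simp [LB_zero]
    rw [hAe, Matrix.det_updateCol_add, Matrix.det_updateCol_add, Matrix.det_updateCol_smul,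
      key P0 P0_eq, key P1 P1_eq, key P2 P2_eq]
    exact ((QTP_P0 _ i j hi hj).add (QTP_P1 _ i j hi hj)).add
      (QNN.X.mul (QTP_P2 _ i j hi hj))
  · have : (Matrix.of fun s t : Fin (n + 1) => LB (i s) (j t)) =
        Matrix.of fun s t => P0 (i s) (j t) := by
      ext1 s t
      have : j t ≠ 0 := by
        by_cases ht : t = 0
        · rwa [ht]
        · exact hpos t ht
      simp [P0_eq _ _ this]
    rw [this]
    exact QTP_P0 _ i j hi hj
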